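/- Let n ≥ 2 and 0 < p < 1. There exist N ∈ ℕ and C > 0 such that for every Schwartz function f ∈ 𝒮(ℝⁿ) and every k̄ ∈ ℤ^{n−1}, ‖□_{k̄}(Tr f)‖_{L^p(ℝ^{n−1})}^p ≤ C Σ_{l∈ℤⁿ, |l̄ − k̄|_∞ ≤ N} ‖□_l f‖_{L^p(ℝⁿ)}^p, where l̄ = (l_1,…,l_{n−1}) and the sum runs over all l_n ∈ ℤ. -/

import Mathlib

open MeasureTheory FourierTransform
open scoped ENNReal NNReal

noncomputable section

/-- `η` is an admissible bump function: smooth, valued in `[0,1]`, equal to `1` on `|t| ≤ 1`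
and vanishing for `|t| ≥ 2`. -/
def IsBump (η : ℝ → ℝ) : Prop :=
  ContDiff ℝ (⊤ : ℕ∞) η ∧ (∀ t, η t ∈ Set.Icc (0:ℝ) 1) ∧ (∀ t, |t| ≤ 1 → η t = 1) ∧
    (∀ t, 2 ≤ |t| → η t = 0)

/-- Japanese bracket `⟨k⟩ = (1+|k|²)^{1/2}` of an integer vector. -/
def jbr {d : ℕ} (k : Fin d → ℤ) : ℝ := (1 + ∑ i, ((k i : ℝ))^2) ^ ((1:ℝ)/2)

/-- `ψ_k`, the normalized window at frequency `k ∈ ℤ^d`. -/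
def unifWindow (η : ℝ → ℝ) {d : ℕ} (k : Fin d → ℤ) (ξ : EuclideanSpace ℝ (Fin d)) : ℝ :=
  (∏ i, η (2 * (ξ i - k i))) / ∑' l : Fin d → ℤ, ∏ i, η (2 * (ξ i - l i))

/-- The frequency-uniform decomposition operator `□_k f = 𝓕⁻¹(ψ_k 𝓕 f)`. -/
def unifBox (η : ℝ → ℝ) {d : ℕ} (k : Fin d → ℤ) (f : EuclideanSpace ℝ (Fin d) → ℂ) :
    EuclideanSpace ℝ (Fin d) → ℂ :=
  𝓕⁻ (fun ξ => (unifWindow η k ξ : ℂ) * 𝓕 f ξ)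

/-- The `ℓ^q` combination of a family of extended nonnegative reals, with the supremum
modification for `q = ∞`. -/
def lqSum {ι : Type*} (q : ℝ≥0∞) (a : ι → ℝ≥0∞) : ℝ≥0∞ :=
  if q = ∞ then ⨆ i, a i else (∑' i, a i ^ q.toReal) ^ (1 / q.toReal)

/-- The modulation space quasi-norm `‖f‖_{M^s_{p,q}(ℝ^d)}`. -/
def modNorm (η : ℝ → ℝ) {d : ℕ} (s : ℝ) (p q : ℝ≥0∞) (f : EuclideanSpace ℝ (Fin d) → ℂ) :
    ℝ≥0∞ :=
  lqSum q (fun k : Fin d → ℤ =>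
    ENNReal.ofReal (jbr k ^ s) * eLpNorm (unifBox η k f) p volume)

/-- The anisotropic modulation space quasi-norm `‖f‖_{M^s_{p,q,r}(ℝ^{m+1})}`. -/
def modNormAniso (η : ℝ → ℝ) {m : ℕ} (s : ℝ) (p q r : ℝ≥0∞)
    (f : EuclideanSpace ℝ (Fin (m+1)) → ℂ) : ℝ≥0∞ :=
  lqSum r (fun kn : ℤ => lqSum q (fun kb : Fin m → ℤ =>
    ENNReal.ofReal (jbr kb ^ s) *
      eLpNorm (unifBox η (Fin.snoc kb kn) f) p volume))

/-- The trace `(Tr f)(x̄) = f(x̄, 0)` on the hyperplane `x_n = 0`. -/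
def traceFn {m : ℕ} (f : EuclideanSpace ℝ (Fin (m+1)) → ℂ)
    (x : EuclideanSpace ℝ (Fin m)) : ℂ :=
  f ((WithLp.equiv 2 (Fin (m+1) → ℝ)).symm
      (Fin.snoc ((WithLp.equiv 2 (Fin m → ℝ)) x) 0))



section PartOne

open scoped RealInnerProductSpace

variable {V : Type*} [NormedAddCommGroup V] [InnerProductSpace ℝ V] [MeasurableSpace V]
  [BorelSpace V] [FiniteDimensional ℝ V]

/-- Elementary Nikolskii inequality `L^r → L^1` for band-limited functions. -/
theorem nikolskii_one {h : V → ℂ} (hc : Continuous h) (hi : Integrable h) (c : V) (R : ℝ)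
    (hs : ∀ ξ, ξ ∉ Metric.closedBall c R → 𝓕 h ξ = 0) {r : ℝ} (hr0 : 0 < r) (hr1 : r < 1) :
    (∫⁻ y, ‖h y‖ₑ) ^ r ≤ (volume (Metric.closedBall (0:V) R)) ^ (1 - r) * ∫⁻ y, ‖h y‖ₑ ^ r := by
  set A := ∫⁻ y, ‖h y‖ₑ with hA
  set v := volume (Metric.closedBall (0:V) R) with hv
  have hAfin : A ≠ ∞ := hi.2.ne
  have hFc : Continuous (𝓕 h) :=
    VectorFourier.fourierIntegral_continuous Real.continuous_fourierChar
      (by exact continuous_inner) hi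
  have hFi : Integrable (𝓕 h) := by
    apply hFc.integrable_of_hasCompactSupport
    exact HasCompactSupport.intro (isCompact_closedBall c R) (fun x hx => hs x hx)
  have hFb : ∀ ξ, ‖𝓕 h ξ‖ₑ ≤ A := by
    intro ξ
    rw [Real.fourier_eq]
    refine (enorm_integral_le_lintegral_enorm _).trans (le_of_eq ?_)
    apply lintegral_congr
    intro y
    rw [← ofReal_norm, Circle.norm_smul, ofReal_norm]
  have hb : ∀ y, ‖h y‖ₑ ≤ v * A := by
    intro y
    have : h y = 𝓕⁻ (𝓕 h) y := by
      rw [hc.fourierInv_fourier_eq hi hFi]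
    rw [this, Real.fourierInv_eq]
    calc ‖∫ v, Real.fourierChar ⟪v, y⟫ • 𝓕 h v‖ₑ
        ≤ ∫⁻ v, ‖Real.fourierChar ⟪v, y⟫ • 𝓕 h v‖ₑ := enorm_integral_le_lintegral_enorm _
      _ ≤ ∫⁻ v, (Metric.closedBall c R).indicator (fun _ => A) v := by
          apply lintegral_mono
          intro z
          simp only
          rw [← ofReal_norm, Circle.norm_smul, ofReal_norm]
          by_cases hz : z ∈ Metric.closedBall c R
          · rw [Set.indicator_of_mem hz]; exact hFb z
          · rw [hs z hz]; simp
      _ = v * A := by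
          rw [lintegral_indicator_const Metric.isClosed_closedBall.measurableSet, mul_comm,
            Measure.addHaar_closedBall_center]
  by_cases hA0 : A = 0
  · rw [hA0, ENNReal.zero_rpow_of_pos hr0]; exact zero_le
  have h1 : A ≤ (v * A) ^ (1 - r) * ∫⁻ y, ‖h y‖ₑ ^ r := by
    rw [← lintegral_const_mul _ (by fun_prop)]
    conv_lhs => rw [hA]
    apply lintegral_mono
    intro y
    simp only
    calc ‖h y‖ₑ = ‖h y‖ₑ ^ ((1 - r) + r) := by simp
      _ = ‖h y‖ₑ ^ (1 - r) * ‖h y‖ₑ ^ r := by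
        rw [ENNReal.rpow_add_of_nonneg _ _ (by linarith) hr0.le]
      _ ≤ _ := by gcongr; exact hb y
  rw [ENNReal.mul_rpow_of_nonneg _ _ (by linarith)] at h1
  have h2 : A = A ^ (1 - r) * A ^ r := by
    rw [← ENNReal.rpow_add_of_nonneg _ _ (by linarith) hr0.le]; simp
  have hx0 : A ^ (1 - r) ≠ 0 := by
    rw [Ne, ENNReal.rpow_eq_zero_iff]; push Not
    exact ⟨fun h => absurd h hA0, fun h => absurd h hAfin⟩
  have hxt : A ^ (1 - r) ≠ ∞ := ENNReal.rpow_ne_top_of_nonneg (by linarith) hAfin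
  rw [← ENNReal.mul_le_mul_iff_right hx0 hxt, ← h2]
  calc A ≤ _ := h1
    _ = _ := by ring

theorem fourier_mul_formula (a b : SchwartzMap V ℂ) (x ξ : V) :
    𝓕 (fun y => (𝓕⁻ (⇑a) (x - y)) * (𝓕⁻ (⇑b) y)) ξ =
      ∫ ζ, Real.fourierChar ⟪ζ, x⟫ • (a ζ * b (ζ + ξ)) := by
  have hga : Integrable (𝓕⁻ (⇑b)) := by
    rw [← SchwartzMap.fourierInv_coe]; exact (𝓕⁻ b).integrable
  have e1 : ∀ y, 𝓕⁻ (⇑a) (x - y) = 𝓕 (fun ζ => Real.fourierChar ⟪ζ, x⟫ • a ζ) y := by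
    intro y
    rw [Real.fourierInv_eq, Real.fourier_eq]
    congr 1; ext ζ
    rw [smul_smul, ← AddChar.map_add_eq_mul, inner_sub_right]
    congr 2; ring
  have key := VectorFourier.integral_fourierIntegral_smul_eq_flip (μ := (volume : Measure V))
    (ν := (volume : Measure V)) (L := innerₗ V)
    (f := fun ζ => Real.fourierChar ⟪ζ, x⟫ • a ζ)
    (g := fun y => Real.fourierChar (-⟪y, ξ⟫) • 𝓕⁻ (⇑b) y)
    Real.continuous_fourierChar continuous_inner
    (by
      have := (Real.fourierIntegral_convergent_iff (μ := (volume : Measure V)) (f := ⇑a) (-x)).2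
        a.integrable
      simpa using this)
    ((Real.fourierIntegral_convergent_iff (μ := (volume : Measure V)) ξ).2 hga)
  rw [Real.fourier_eq]
  calc _ = ∫ y, (𝓕 (fun ζ => Real.fourierChar ⟪ζ, x⟫ • a ζ) y) •
        (Real.fourierChar (-⟪y, ξ⟫) • 𝓕⁻ (⇑b) y) := by
        congr 1; ext y
        rw [e1]
        simp only [Circle.smul_def, smul_eq_mul]
        ring
    _ = _ := key
    _ = _ := by
        congr 1; ext ζ
        have : VectorFourier.fourierIntegral Real.fourierChar (volume : Measure V) (innerₗ V).flip
          (fun y => Real.fourierChar (-⟪y, ξ⟫) • 𝓕⁻ (⇑b) y) ζ = b (ζ + ξ) := by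
          have h2 : b (ζ + ξ) = 𝓕 (𝓕⁻ (⇑b)) (ζ + ξ) := by
            rw [← SchwartzMap.fourierInv_coe, ← SchwartzMap.fourier_coe]
            rw [FourierTransform.fourier_fourierInv_eq]
          rw [h2, Real.fourier_eq]
          unfold VectorFourier.fourierIntegral
          congr 1; ext y
          rw [smul_smul, ← AddChar.map_add_eq_mul, inner_add_right]
          simp only [flip_innerₗ, innerₗ_apply_apply]
          congr 2; ring
        rw [this]
        simp only [Circle.smul_def, smul_eq_mul]
        ring

/-- The pointwise estimate for a band-limited convolution. -/
theorem piece_bound (a b : SchwartzMap V ℂ) (c₁ c₂ : V) (R : ℝ)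
    (ha : ∀ ζ, ζ ∉ Metric.closedBall c₁ R → a ζ = 0)
    (hb : ∀ ζ, ζ ∉ Metric.closedBall c₂ R → b ζ = 0)
    {r : ℝ} (hr0 : 0 < r) (hr1 : r < 1) (x : V) :
    ‖∫ ζ, Real.fourierChar ⟪ζ, x⟫ • (a ζ * b ζ)‖ₑ ^ r ≤
      (volume (Metric.closedBall (0:V) (2 * R))) ^ (1 - r) *
        ∫⁻ y, ‖𝓕⁻ (⇑a) (x - y)‖ₑ ^ r * ‖𝓕⁻ (⇑b) y‖ₑ ^ r := by
  set h : V → ℂ := fun y => (𝓕⁻ (⇑a) (x - y)) * (𝓕⁻ (⇑b) y) with hh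
  have hA : 𝓕⁻ (⇑a) = ⇑(𝓕⁻ a : SchwartzMap V ℂ) := (SchwartzMap.fourierInv_coe a).symm
  have hB : 𝓕⁻ (⇑b) = ⇑(𝓕⁻ b : SchwartzMap V ℂ) := (SchwartzMap.fourierInv_coe b).symm
  have hca : Continuous (𝓕⁻ (⇑a)) := by rw [hA]; exact (𝓕⁻ a).continuous
  have hcb : Continuous (𝓕⁻ (⇑b)) := by rw [hB]; exact (𝓕⁻ b).continuous
  have hc : Continuous h := by fun_prop
  have hi : Integrable h := by
    obtain ⟨D, _, hD⟩ := (𝓕⁻ a).decay 0 0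
    refine Integrable.bdd_mul (c := D) (by rw [hB]; exact (𝓕⁻ b).integrable)
      (by fun_prop : Continuous fun y => 𝓕⁻ (⇑a) (x - y)).aestronglyMeasurable ?_
    refine Filter.Eventually.of_forall (fun y => ?_)
    rw [hA]; simpa using hD (x - y)
  have hs : ∀ ξ, ξ ∉ Metric.closedBall (c₂ - c₁) (2 * R) → 𝓕 h ξ = 0 := by
    intro ξ hξ
    rw [hh, fourier_mul_formula]
    rw [← integral_zero V ℂ]
    congr 1; ext ζ
    by_cases h1 : ζ ∈ Metric.closedBall c₁ R
    · by_cases h2 : ζ + ξ ∈ Metric.closedBall c₂ R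
      · exfalso; apply hξ
        rw [Metric.mem_closedBall, dist_eq_norm] at *
        calc ‖ξ - (c₂ - c₁)‖ = ‖(ζ + ξ - c₂) - (ζ - c₁)‖ := by congr 1; abel
          _ ≤ ‖ζ + ξ - c₂‖ + ‖ζ - c₁‖ := norm_sub_le _ _
          _ ≤ 2 * R := by linarith
      · rw [hb _ h2]; simp
    · rw [ha _ h1]; simp
  have h0 : ∫ ζ, Real.fourierChar ⟪ζ, x⟫ • (a ζ * b ζ) = 𝓕 h 0 := by
    rw [hh, fourier_mul_formula]; simp
  calc _ ≤ (∫⁻ y, ‖h y‖ₑ) ^ r := by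
        apply ENNReal.rpow_le_rpow _ hr0.le
        rw [h0, Real.fourier_eq]
        refine (enorm_integral_le_lintegral_enorm _).trans (le_of_eq ?_)
        apply lintegral_congr
        intro y
        rw [← ofReal_norm, Circle.norm_smul, ofReal_norm]
    _ ≤ _ := nikolskii_one hc hi (c₂ - c₁) (2 * R) hs hr0 hr1
    _ = _ := by
        congr 1
        apply lintegral_congr
        intro y
        rw [hh]; simp only
        rw [enorm_mul, ENNReal.mul_rpow_of_nonneg _ _ hr0.le]

end PartOne

section PartTwo

theorem bump_zero_of_ne {η : ℝ → ℝ} (hη : IsBump η) {d : ℕ} {ξ : EuclideanSpace ℝ (Fin d)}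
    {l : Fin d → ℤ} (h : ∏ i, η (2 * (ξ i - l i)) ≠ 0) (i : Fin d) : |ξ i - l i| < 1 := by
  by_contra hc
  push Not at hc
  apply h
  apply Finset.prod_eq_zero (Finset.mem_univ i)
  apply hη.2.2.2
  rw [abs_mul]; norm_num; linarith

theorem bump_support_local {η : ℝ → ℝ} (hη : IsBump η) {d : ℕ}
    (ξ₀ ξ : EuclideanSpace ℝ (Fin d)) (hξ : ∀ i, |ξ i - ξ₀ i| < 1) (l : Fin d → ℤ)
    (hl : l ∉ Fintype.piFinset (fun i => Finset.Icc (⌊ξ₀ i⌋ - 3) (⌊ξ₀ i⌋ + 3))) :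
    ∏ i, η (2 * (ξ i - l i)) = 0 := by
  by_contra h
  apply hl
  rw [Fintype.mem_piFinset]
  intro i
  have h1 := abs_lt.1 (bump_zero_of_ne hη h i)
  have h2 := abs_lt.1 (hξ i)
  have h3 := Int.floor_le (ξ₀ i)
  have h4 := Int.lt_floor_add_one (ξ₀ i)
  rw [Finset.mem_Icc]
  constructor
  · have : ((⌊ξ₀ i⌋ - 3 : ℤ) : ℝ) ≤ (l i : ℝ) := by push_cast; linarith
    exact_mod_cast this
  · have : (l i : ℝ) ≤ ((⌊ξ₀ i⌋ + 3 : ℤ) : ℝ) := by push_cast; linarith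
    exact_mod_cast this

theorem bump_summable {η : ℝ → ℝ} (hη : IsBump η) {d : ℕ} (ξ : EuclideanSpace ℝ (Fin d)) :
    Summable (fun l : Fin d → ℤ => ∏ i, η (2 * (ξ i - l i))) :=
  summable_of_ne_finset_zero
    (s := Fintype.piFinset (fun i => Finset.Icc (⌊ξ i⌋ - 3) (⌊ξ i⌋ + 3)))
    (fun l hl => bump_support_local hη ξ ξ (by simp) l hl)

theorem bump_prod_nonneg {η : ℝ → ℝ} (hη : IsBump η) {d : ℕ} (ξ : EuclideanSpace ℝ (Fin d))
    (l : Fin d → ℤ) : 0 ≤ ∏ i, η (2 * (ξ i - l i)) :=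
  Finset.prod_nonneg (fun i _ => (hη.2.1 _).1)

theorem den_ge_one {η : ℝ → ℝ} (hη : IsBump η) {d : ℕ} (ξ : EuclideanSpace ℝ (Fin d)) :
    1 ≤ ∑' l : Fin d → ℤ, ∏ i, η (2 * (ξ i - l i)) := by
  have h := (bump_summable hη ξ).le_tsum (fun i => round (ξ i))
    (fun l _ => bump_prod_nonneg hη ξ l)
  refine le_trans (le_of_eq ?_) h
  symm
  apply Finset.prod_eq_one
  intro i _
  apply hη.2.2.1
  rw [abs_mul]
  have := abs_sub_round (ξ i)
  norm_num
  linarith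

theorem bump_prod_contDiff {η : ℝ → ℝ} (hη : IsBump η) {d : ℕ} (l : Fin d → ℤ) :
    ContDiff ℝ (⊤ : ℕ∞) (fun ξ : EuclideanSpace ℝ (Fin d) => ∏ i, η (2 * (ξ i - l i))) := by
  apply contDiff_prod
  intro i _
  apply hη.1.comp
  have : ContDiff ℝ (⊤ : ℕ∞) (fun ξ : EuclideanSpace ℝ (Fin d) => ξ i) :=
    (EuclideanSpace.proj i : EuclideanSpace ℝ (Fin d) →L[ℝ] ℝ).contDiff
  exact contDiff_const.mul (this.sub contDiff_const)

theorem den_contDiff {η : ℝ → ℝ} (hη : IsBump η) (d : ℕ) :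
    ContDiff ℝ (⊤ : ℕ∞) (fun ξ : EuclideanSpace ℝ (Fin d) =>
      ∑' l : Fin d → ℤ, ∏ i, η (2 * (ξ i - l i))) := by
  rw [contDiff_iff_contDiffAt]
  intro ξ₀
  have h1 : ContDiffAt ℝ (⊤ : ℕ∞) (fun ξ : EuclideanSpace ℝ (Fin d) =>
      ∑ l ∈ Fintype.piFinset (fun i => Finset.Icc (⌊ξ₀ i⌋ - 3) (⌊ξ₀ i⌋ + 3)),
        ∏ i, η (2 * (ξ i - l i))) ξ₀ :=
    (ContDiff.sum (fun l _ => bump_prod_contDiff hη l)).contDiffAt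
  refine h1.congr_of_eventuallyEq ?_
  filter_upwards [Metric.ball_mem_nhds ξ₀ one_pos] with ξ hξ
  apply tsum_eq_sum
  intro l hl
  apply bump_support_local hη ξ₀ ξ _ l hl
  intro i
  have := PiLp.norm_apply_le (ξ - ξ₀) i
  rw [Metric.mem_ball, dist_eq_norm] at hξ
  simp only [PiLp.sub_apply, Real.norm_eq_abs] at this
  linarith

theorem window_contDiff {η : ℝ → ℝ} (hη : IsBump η) {d : ℕ} (k : Fin d → ℤ) :
    ContDiff ℝ (⊤ : ℕ∞) (unifWindow η k) :=
  (bump_prod_contDiff hη k).div (den_contDiff hη d)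
    (fun ξ => (zero_lt_one.trans_le (den_ge_one hη ξ)).ne')

theorem window_support {η : ℝ → ℝ} (hη : IsBump η) {d : ℕ} {k : Fin d → ℤ}
    {ξ : EuclideanSpace ℝ (Fin d)} (h : unifWindow η k ξ ≠ 0) (i : Fin d) : |ξ i - k i| < 1 := by
  apply bump_zero_of_ne hη _ i
  intro h0
  apply h
  unfold unifWindow
  rw [h0, zero_div]

theorem window_nonneg {η : ℝ → ℝ} (hη : IsBump η) {d : ℕ} (k : Fin d → ℤ)
    (ξ : EuclideanSpace ℝ (Fin d)) : 0 ≤ unifWindow η k ξ :=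
  div_nonneg (bump_prod_nonneg hη ξ k) (zero_le_one.trans (den_ge_one hη ξ))

theorem window_hasSum {η : ℝ → ℝ} (hη : IsBump η) {d : ℕ} (ξ : EuclideanSpace ℝ (Fin d)) :
    HasSum (fun k : Fin d → ℤ => unifWindow η k ξ) 1 := by
  have h := (bump_summable hη ξ).hasSum.div_const
    (∑' l : Fin d → ℤ, ∏ i, η (2 * (ξ i - l i)))
  rwa [div_self (zero_lt_one.trans_le (den_ge_one hη ξ)).ne'] at h

theorem window_translate {η : ℝ → ℝ} {d : ℕ} (k : Fin d → ℤ)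
    (ξ : EuclideanSpace ℝ (Fin d)) :
    unifWindow η k ξ = unifWindow η 0 (ξ - WithLp.toLp 2 (fun i => (k i : ℝ))) := by
  unfold unifWindow
  congr 1
  · simp
  · rw [← (Equiv.addRight k).tsum_eq]
    apply tsum_congr
    intro l
    apply Finset.prod_congr rfl
    intro i _
    congr 1
    simp
    ring

theorem norm_le_card_mul {d : ℕ} (ξ : EuclideanSpace ℝ (Fin d)) {c : ℝ} (hc : ∀ i, |ξ i| ≤ c) :
    ‖ξ‖ ≤ d * c := by
  calc ‖ξ‖ = ‖∑ i, ξ i • EuclideanSpace.single i (1:ℝ)‖ := by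
        congr 1; ext j; simp [Finset.sum_apply, Pi.single_apply]
    _ ≤ ∑ i, ‖ξ i • EuclideanSpace.single i (1:ℝ)‖ := norm_sum_le _ _
    _ ≤ ∑ _i : Fin d, c := by
        apply Finset.sum_le_sum
        intro i _
        rw [norm_smul]; simpa using hc i
    _ = d * c := by simp

theorem window_eq_zero_of_far {η : ℝ → ℝ} (hη : IsBump η) {d : ℕ} (k : Fin d → ℤ)
    (ξ : EuclideanSpace ℝ (Fin d))
    (h : ξ ∉ Metric.closedBall (WithLp.toLp 2 (fun i => (k i : ℝ))) (2 * d : ℝ)) :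
    unifWindow η k ξ = 0 := by
  by_contra h0
  apply h
  rw [Metric.mem_closedBall, dist_eq_norm]
  have := norm_le_card_mul (ξ - WithLp.toLp 2 (fun i => (k i : ℝ))) (c := 2)
    (fun i => by simpa using (window_support hη h0 i).le.trans one_le_two)
  linarith

/-- The piece `ψ_k F` of a Schwartz function as a Schwartz function. -/
theorem exists_windowed {η : ℝ → ℝ} (hη : IsBump η) {d : ℕ} (k : Fin d → ℤ)
    {F : EuclideanSpace ℝ (Fin d) → ℂ} (hF : ContDiff ℝ (⊤ : ℕ∞) F) :
    ∃ b : SchwartzMap (EuclideanSpace ℝ (Fin d)) ℂ, ∀ ξ, b ξ = (unifWindow η k ξ : ℂ) * F ξ := by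
  have h1 : ContDiff ℝ (⊤ : ℕ∞) (fun ξ => (unifWindow η k ξ : ℂ) * F ξ) :=
    (Complex.ofRealCLM.contDiff.comp (window_contDiff hη k)).mul hF
  have h2 : HasCompactSupport (fun ξ => (unifWindow η k ξ : ℂ) * F ξ) :=
    HasCompactSupport.intro (isCompact_closedBall _ _)
      (fun ξ hξ => by rw [window_eq_zero_of_far hη k ξ hξ]; simp)
  exact ⟨h2.toSchwartzMap h1, fun ξ => rfl⟩

end PartTwo

section PartThree

open scoped RealInnerProductSpace

/-- Forget the last coordinate. -/
def restrLast (m : ℕ) : EuclideanSpace ℝ (Fin (m+1)) →L[ℝ] EuclideanSpace ℝ (Fin m) :=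
  LinearMap.toContinuousLinearMap
    { toFun := fun ξ => WithLp.toLp 2 (fun i => ξ i.castSucc)
      map_add' := fun x y => by ext i; simp
      map_smul' := fun c x => by ext i; simp }

/-- Append a zero coordinate. -/
def appZero (m : ℕ) : EuclideanSpace ℝ (Fin m) →L[ℝ] EuclideanSpace ℝ (Fin (m+1)) :=
  LinearMap.toContinuousLinearMap
    { toFun := fun x => WithLp.toLp 2 (Fin.snoc (α := fun _ => ℝ) (fun i => x i) 0)
      map_add' := fun x y => by
        ext i; refine Fin.lastCases ?_ (fun j => ?_) i <;> simp
      map_smul' := fun c x => by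
        ext i; refine Fin.lastCases ?_ (fun j => ?_) i <;> simp }

@[simp] theorem restrLast_apply {m : ℕ} (ξ : EuclideanSpace ℝ (Fin (m+1))) (i : Fin m) :
    restrLast m ξ i = ξ i.castSucc := rfl

@[simp] theorem appZero_castSucc {m : ℕ} (x : EuclideanSpace ℝ (Fin m)) (i : Fin m) :
    appZero m x i.castSucc = x i := by
  change Fin.snoc (α := fun _ => ℝ) (fun i => x i) 0 i.castSucc = x i
  simp

@[simp] theorem appZero_last {m : ℕ} (x : EuclideanSpace ℝ (Fin m)) :
    appZero m x (Fin.last m) = 0 := by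
  change Fin.snoc (α := fun _ => ℝ) (fun i => x i) 0 (Fin.last m) = 0
  simp

theorem traceFn_eq {m : ℕ} (f : EuclideanSpace ℝ (Fin (m+1)) → ℂ) (x : EuclideanSpace ℝ (Fin m)) :
    traceFn f x = f (appZero m x) := rfl

theorem restr_appZero {m : ℕ} (x : EuclideanSpace ℝ (Fin m)) :
    restrLast m (appZero m x) = x := by ext i; simp

theorem inner_appZero {m : ℕ} (ξ : EuclideanSpace ℝ (Fin (m+1))) (x : EuclideanSpace ℝ (Fin m)) :
    ⟪ξ, appZero m x⟫ = ⟪restrLast m ξ, x⟫ := by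
  simp [PiLp.inner_apply, Fin.sum_univ_castSucc]

theorem norm_restr_le {m : ℕ} (ξ : EuclideanSpace ℝ (Fin (m+1))) : ‖restrLast m ξ‖ ≤ ‖ξ‖ := by
  rw [EuclideanSpace.norm_eq, EuclideanSpace.norm_eq]
  apply Real.sqrt_le_sqrt
  rw [Fin.sum_univ_castSucc]
  simp only [restrLast_apply]
  have : 0 ≤ ‖ξ (Fin.last m)‖ ^ 2 := by positivity
  linarith

theorem norm_appZero {m : ℕ} (x : EuclideanSpace ℝ (Fin m)) : ‖appZero m x‖ = ‖x‖ := by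
  rw [EuclideanSpace.norm_eq, EuclideanSpace.norm_eq, Fin.sum_univ_castSucc]
  simp

theorem exists_trace_schwartz {m : ℕ} (f : SchwartzMap (EuclideanSpace ℝ (Fin (m+1))) ℂ) :
    ∃ T : SchwartzMap (EuclideanSpace ℝ (Fin m)) ℂ, ⇑T = traceFn (⇑f) := by
  have hanti : AntilipschitzWith 1 (appZero m) := by
    apply AddMonoidHomClass.antilipschitz_of_bound
    intro x; rw [norm_appZero]; simp
  exact ⟨SchwartzMap.compCLMOfAntilipschitz ℂ (appZero m).hasTemperateGrowth hanti f, rfl⟩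

theorem fourierChar_contDiff {m : ℕ} (x : EuclideanSpace ℝ (Fin m)) :
    ContDiff ℝ (⊤ : ℕ∞) (fun ξ : EuclideanSpace ℝ (Fin m) => ((Real.fourierChar ⟪ξ, x⟫ : Circle) : ℂ)) := by
  simp_rw [Real.fourierChar_apply]
  apply ContDiff.cexp
  apply ContDiff.mul _ contDiff_const
  apply Complex.ofRealCLM.contDiff.comp
  exact contDiff_const.mul (contDiff_id.inner ℝ contDiff_const)

theorem box_trace_formula {m : ℕ} {η : ℝ → ℝ} (hη : IsBump η)
    (f : SchwartzMap (EuclideanSpace ℝ (Fin (m+1))) ℂ) (k : Fin m → ℤ)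
    (x : EuclideanSpace ℝ (Fin m)) :
    unifBox η k (traceFn (⇑f)) x =
      ∫ ξ, Real.fourierChar ⟪ξ, appZero m x⟫ •
        ((unifWindow η k (restrLast m ξ) : ℂ) * 𝓕 (⇑f) ξ) := by
  obtain ⟨T, hT⟩ := exists_trace_schwartz f
  obtain ⟨w, hw⟩ := exists_windowed hη k (fourierChar_contDiff x)
  unfold unifBox
  rw [Real.fourierInv_eq, ← hT]
  have hTf : ∀ y, T y = VectorFourier.fourierIntegral Real.fourierChar volume
      (-((innerₗ (EuclideanSpace ℝ (Fin m))).comp (restrLast m).toLinearMap)) (𝓕 (⇑f)) y := by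
    intro y
    rw [hT, traceFn_eq]
    have h2 : f (appZero m y) = 𝓕⁻ (𝓕 (⇑f)) (appZero m y) := by
      rw [← SchwartzMap.fourier_coe, ← SchwartzMap.fourierInv_coe]
      rw [FourierTransform.fourierInv_fourier_eq]
    rw [h2, Real.fourierInv_eq]
    unfold VectorFourier.fourierIntegral
    congr 1; ext ξ
    rw [inner_appZero]
    simp
  have hfi : Integrable (𝓕 (⇑f)) := by
    rw [← SchwartzMap.fourier_coe]; exact (𝓕 f).integrable
  have hwi : Integrable (𝓕 (⇑w)) := by
    rw [← SchwartzMap.fourier_coe]; exact (𝓕 w).integrable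
  have key := VectorFourier.integral_fourierIntegral_smul_eq_flip
    (μ := (volume : Measure (EuclideanSpace ℝ (Fin (m+1)))))
    (ν := (volume : Measure (EuclideanSpace ℝ (Fin m))))
    (L := -((innerₗ (EuclideanSpace ℝ (Fin m))).comp (restrLast m).toLinearMap))
    (f := 𝓕 (⇑f)) (g := 𝓕 (⇑w)) Real.continuous_fourierChar
    (by
      have : Continuous fun p : EuclideanSpace ℝ (Fin (m+1)) × EuclideanSpace ℝ (Fin m) =>
        -⟪restrLast m p.1, p.2⟫ := by fun_prop
      exact this) hfi hwi
  calc _ = ∫ v, w v * (𝓕 T) v := by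
        congr 1; ext v
        rw [hw, SchwartzMap.fourier_coe, Circle.smul_def, smul_eq_mul]
        ring
    _ = ∫ y, (𝓕 w) y * T y := (SchwartzMap.integral_fourier_mul_eq w T).symm
    _ = ∫ y, (VectorFourier.fourierIntegral Real.fourierChar volume
      (-((innerₗ (EuclideanSpace ℝ (Fin m))).comp (restrLast m).toLinearMap)) (𝓕 (⇑f)) y) •
        (𝓕 (⇑w) y) := by
        congr 1; ext y
        rw [← hTf, smul_eq_mul, SchwartzMap.fourier_coe]
        ring
    _ = _ := key
    _ = _ := by
        congr 1; ext ξ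
        have : VectorFourier.fourierIntegral Real.fourierChar volume
            (-((innerₗ (EuclideanSpace ℝ (Fin m))).comp (restrLast m).toLinearMap)).flip
              (𝓕 (⇑w)) ξ = w (restrLast m ξ) := by
          have h2 : w (restrLast m ξ) = 𝓕⁻ (𝓕 (⇑w)) (restrLast m ξ) := by
            rw [← SchwartzMap.fourier_coe, ← SchwartzMap.fourierInv_coe]
            rw [FourierTransform.fourierInv_fourier_eq]
          rw [h2, Real.fourierInv_eq]
          unfold VectorFourier.fourierIntegral
          congr 1; ext y
          congr 2
          simp [real_inner_comm]
        rw [this, hw, inner_appZero, Circle.smul_def, smul_eq_mul, smul_eq_mul]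
        ring

theorem slice_bound {m : ℕ} (Φ : SchwartzMap (EuclideanSpace ℝ (Fin (m+1))) ℂ)
    {r : ℝ} (hr0 : 0 < r) :
    ∃ K : ℝ≥0∞, K ≠ ∞ ∧ ∀ y : EuclideanSpace ℝ (Fin (m+1)),
      ∫⁻ x : EuclideanSpace ℝ (Fin m), ‖Φ (appZero m x - y)‖ₑ ^ r ≤ K := by
  obtain ⟨M, hM⟩ := exists_nat_gt ((m : ℝ) / r)
  have hMr : (m : ℝ) < M * r := by rwa [div_lt_iff₀ hr0] at hM
  obtain ⟨D, hD⟩ : ∃ D : ℝ, ∀ z, (1 + ‖z‖) ^ M * ‖Φ z‖ ≤ D :=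
    ⟨_, fun z => by
      simpa using SchwartzMap.one_add_le_sup_seminorm_apply (𝕜 := ℝ) (m := (M, 0)) le_rfl le_rfl Φ z⟩
  have hD0 : 0 ≤ D := le_trans (by positivity) (hD 0)
  have hfin := finite_integral_one_add_norm (E := EuclideanSpace ℝ (Fin m))
    (μ := volume) (r := M * r) (by simpa using hMr)
  refine ⟨ENNReal.ofReal (D ^ r) * ∫⁻ x : EuclideanSpace ℝ (Fin m),
    ENNReal.ofReal ((1 + ‖x‖) ^ (-(M * r))), ENNReal.mul_ne_top ENNReal.ofReal_ne_top hfin.ne, ?_⟩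
  intro y
  rw [← lintegral_sub_right_eq_self (fun x : EuclideanSpace ℝ (Fin m) =>
      ENNReal.ofReal ((1 + ‖x‖) ^ (-(M * r)))) (restrLast m y),
    ← lintegral_const_mul _ (by fun_prop)]
  apply lintegral_mono
  intro x
  simp only
  rw [← ENNReal.ofReal_mul (by positivity), ← ofReal_norm,
    ENNReal.ofReal_rpow_of_nonneg (norm_nonneg _) hr0.le]
  apply ENNReal.ofReal_le_ofReal
  have h1 : ‖x - restrLast m y‖ ≤ ‖appZero m x - y‖ := by
    have := norm_restr_le (appZero m x - y)
    rwa [map_sub, restr_appZero] at this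
  have h2 : ‖Φ (appZero m x - y)‖ ≤ D * (1 + ‖x - restrLast m y‖) ^ (-(M:ℝ)) := by
    rw [Real.rpow_neg (by positivity), Real.rpow_natCast, ← div_eq_mul_inv,
      le_div_iff₀ (by positivity), mul_comm]
    refine le_trans ?_ (hD (appZero m x - y))
    gcongr
  calc _ ≤ (D * (1 + ‖x - restrLast m y‖) ^ (-(M:ℝ))) ^ r := by
        gcongr
    _ = _ := by
        rw [Real.mul_rpow hD0 (by positivity), ← Real.rpow_mul (by positivity)]
        congr 2; ring

theorem norm_fourierInv_translate {V : Type*} [NormedAddCommGroup V] [InnerProductSpace ℝ V]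
    [MeasurableSpace V] [BorelSpace V] [FiniteDimensional ℝ V] (a a₀ : V → ℂ) (c : V)
    (h : ∀ ξ, a ξ = a₀ (ξ - c)) (z : V) : ‖𝓕⁻ a z‖ₑ = ‖𝓕⁻ a₀ z‖ₑ := by
  have : 𝓕⁻ a z = Real.fourierChar ⟪c, z⟫ • 𝓕⁻ a₀ z := by
    rw [Real.fourierInv_eq, Real.fourierInv_eq,
      ← integral_sub_right_eq_self (fun v => Real.fourierChar ⟪v, z⟫ • a₀ v) c,
      Circle.smul_def, ← integral_smul]
    simp_rw [← Circle.smul_def]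
    congr 1; ext v
    rw [h, smul_smul, ← AddChar.map_add_eq_mul, ← inner_add_left]
    congr 3; abel
  rw [this, ← ofReal_norm, Circle.norm_smul, ofReal_norm]

theorem tsum_rpow_le' {ι : Type*} (u : ι → ℝ≥0∞) {r : ℝ} (hr0 : 0 < r) (hr1 : r < 1) :
    (∑' i, u i) ^ r ≤ ∑' i, u i ^ r := by
  have h1 : Filter.Tendsto (fun s : Finset ι => (∑ i ∈ s, u i) ^ r) Filter.atTop
      (nhds ((∑' i, u i) ^ r)) :=
    (ENNReal.continuous_rpow_const.tendsto _).comp ENNReal.summable.hasSum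
  refine le_of_tendsto' h1 (fun s => ?_)
  refine le_trans ?_ (ENNReal.sum_le_tsum s)
  classical
  induction s using Finset.induction_on with
  | empty => simp [ENNReal.zero_rpow_of_pos hr0]
  | insert i s hi ih =>
    rw [Finset.sum_insert hi, Finset.sum_insert hi]
    exact (ENNReal.rpow_add_le_add_rpow _ _ hr0.le hr1.le).trans (by gcongr)

end PartThree

section PartFour

open scoped RealInnerProductSpace

/-- The enlarged symbol `ψ_k(ξ̄) η(ξ_n - t)`. -/
theorem exists_symbol {m : ℕ} {η : ℝ → ℝ} (hη : IsBump η) (k : Fin m → ℤ) (t : ℤ) :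
    ∃ a : SchwartzMap (EuclideanSpace ℝ (Fin (m+1))) ℂ,
      (∀ ξ, a ξ = (unifWindow η k (restrLast m ξ) : ℂ) * (η (ξ (Fin.last m) - t) : ℂ)) ∧
      (∀ ξ, ξ ∉ Metric.closedBall
        (WithLp.toLp 2 (fun i => ((Fin.snoc (α := fun _ => ℤ) k t i : ℤ) : ℝ)))
        (2 * ((m+1 : ℕ) : ℝ)) → a ξ = 0) := by
  have h0 : ∀ ξ : EuclideanSpace ℝ (Fin (m+1)), ξ ∉ Metric.closedBall
        (WithLp.toLp 2 (fun i => ((Fin.snoc (α := fun _ => ℤ) k t i : ℤ) : ℝ)))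
        (2 * ((m+1 : ℕ) : ℝ)) →
      (unifWindow η k (restrLast m ξ) : ℂ) * (η (ξ (Fin.last m) - t) : ℂ) = 0 := by
    intro ξ hξ
    by_contra hne
    apply hξ
    have hn1 : unifWindow η k (restrLast m ξ) ≠ 0 := fun h => hne (by rw [h]; simp)
    have hn2 : η (ξ (Fin.last m) - t) ≠ 0 := fun h => hne (by rw [h]; simp)
    rw [Metric.mem_closedBall, dist_eq_norm]
    have := norm_le_card_mul
      (ξ - WithLp.toLp 2 (fun i => ((Fin.snoc (α := fun _ => ℤ) k t i : ℤ) : ℝ))) (c := 2)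
      (fun i => by
        refine Fin.lastCases ?_ (fun j => ?_) i
        · have : ¬ (2 ≤ |ξ (Fin.last m) - t|) := fun h => hn2 (hη.2.2.2 _ h)
          simpa using (not_le.1 this).le
        · have := window_support hη hn1 j
          simp only [restrLast_apply] at this
          simpa using this.le.trans one_le_two)
    linarith
  have h1 : ContDiff ℝ (⊤ : ℕ∞) (fun ξ : EuclideanSpace ℝ (Fin (m+1)) =>
      (unifWindow η k (restrLast m ξ) : ℂ) * (η (ξ (Fin.last m) - t) : ℂ)) := by
    apply ContDiff.mul
    · exact Complex.ofRealCLM.contDiff.comp ((window_contDiff hη k).comp (restrLast m).contDiff)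
    · have : ContDiff ℝ (⊤ : ℕ∞) (fun ξ : EuclideanSpace ℝ (Fin (m+1)) => ξ (Fin.last m)) :=
        (EuclideanSpace.proj (Fin.last m) : EuclideanSpace ℝ (Fin (m+1)) →L[ℝ] ℝ).contDiff
      exact Complex.ofRealCLM.contDiff.comp (hη.1.comp (this.sub contDiff_const))
  exact ⟨(HasCompactSupport.intro (isCompact_closedBall _ _) h0).toSchwartzMap h1,
    fun ξ => rfl, h0⟩

/-- Decomposition of the box of the trace. -/
theorem box_trace_tsum {m : ℕ} {η : ℝ → ℝ} (hη : IsBump η)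
    (f : SchwartzMap (EuclideanSpace ℝ (Fin (m+1))) ℂ) (k : Fin m → ℤ)
    (x : EuclideanSpace ℝ (Fin m)) :
    unifBox η k (traceFn (⇑f)) x =
      ∑' l : Fin (m+1) → ℤ, ∫ ξ, Real.fourierChar ⟪ξ, appZero m x⟫ •
        ((unifWindow η k (restrLast m ξ) : ℂ) * ((unifWindow η l ξ : ℂ) * 𝓕 (⇑f) ξ)) := by
  obtain ⟨F, hF⟩ : ∃ F : SchwartzMap (EuclideanSpace ℝ (Fin (m+1))) ℂ, ⇑F = 𝓕 (⇑f) :=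
    ⟨𝓕 f, SchwartzMap.fourier_coe f⟩
  rw [box_trace_formula hη, ← hF]
  have hcw : Continuous (fun ξ => (unifWindow η k (restrLast m ξ) : ℂ)) :=
    Complex.continuous_ofReal.comp ((window_contDiff hη k).continuous.comp (restrLast m).continuous)
  have hcl : ∀ l : Fin (m+1) → ℤ, Continuous (fun ξ => (unifWindow η l ξ : ℂ)) := fun l =>
    Complex.continuous_ofReal.comp (window_contDiff hη l).continuous
  have hce : Continuous (fun ξ : EuclideanSpace ℝ (Fin (m+1)) =>
      ((Real.fourierChar ⟪ξ, appZero m x⟫ : Circle) : ℂ)) :=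
    (fourierChar_contDiff (appZero m x)).continuous
  have hFc := F.continuous
  have hle : ∀ ξ, unifWindow η k (restrLast m ξ) ≤ 1 := fun ξ =>
    le_hasSum (window_hasSum hη _) k (fun j _ => window_nonneg hη j _)
  rw [← integral_tsum]
  · congr 1; ext ξ
    have h1 : HasSum (fun l : Fin (m+1) → ℤ => (unifWindow η l ξ : ℂ)) 1 := by
      have h0 := Complex.hasSum_ofReal.2 (window_hasSum hη ξ)
      rwa [Complex.ofReal_one] at h0
    have h2 := ((h1.mul_right (F ξ)).mul_left (unifWindow η k (restrLast m ξ) : ℂ)).mul_left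
      ((Real.fourierChar ⟪ξ, appZero m x⟫ : Circle) : ℂ)
    simp only [Circle.smul_def, smul_eq_mul]
    rw [h2.tsum_eq, one_mul]
  · intro l
    simp only [Circle.smul_def, smul_eq_mul]
    have := hcl l
    exact Continuous.aestronglyMeasurable (by fun_prop)
  · rw [← lintegral_tsum]
    · refine ne_of_lt (lt_of_le_of_lt ?_ (F.integrable (μ := volume)).2)
      apply lintegral_mono
      intro ξ
      simp only
      have hs : ∑' l : Fin (m+1) → ℤ, ‖(unifWindow η l ξ : ℂ)‖ₑ = 1 := by
        have h3 : ∀ l : Fin (m+1) → ℤ, ‖(unifWindow η l ξ : ℂ)‖ₑ =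
            ENNReal.ofReal (unifWindow η l ξ) := by
          intro l
          rw [← ofReal_norm, Complex.norm_real, Real.norm_of_nonneg (window_nonneg hη l ξ)]
        simp_rw [h3]
        rw [← ENNReal.ofReal_tsum_of_nonneg (fun l => window_nonneg hη l ξ)
          (window_hasSum hη ξ).summable, (window_hasSum hη ξ).tsum_eq, ENNReal.ofReal_one]
      have h4 : ∀ l : Fin (m+1) → ℤ, ‖Real.fourierChar ⟪ξ, appZero m x⟫ •
        ((unifWindow η k (restrLast m ξ) : ℂ) * ((unifWindow η l ξ : ℂ) * F ξ))‖ₑ ≤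
          ‖(unifWindow η l ξ : ℂ)‖ₑ * ‖F ξ‖ₑ := by
        intro l
        rw [← ofReal_norm, Circle.norm_smul, ofReal_norm, enorm_mul, enorm_mul]
        have : ‖(unifWindow η k (restrLast m ξ) : ℂ)‖ₑ ≤ 1 := by
          rw [← ofReal_norm, Complex.norm_real, Real.norm_of_nonneg (window_nonneg hη k _)]
          exact ENNReal.ofReal_le_one.2 (hle ξ)
        calc _ ≤ 1 * (‖(unifWindow η l ξ : ℂ)‖ₑ * ‖F ξ‖ₑ) := by gcongr
          _ = _ := one_mul _
      calc _ ≤ ∑' l : Fin (m+1) → ℤ, ‖(unifWindow η l ξ : ℂ)‖ₑ * ‖F ξ‖ₑ :=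
            ENNReal.tsum_le_tsum h4
        _ = _ := by rw [ENNReal.tsum_mul_right, hs, one_mul]
    · intro l
      simp only [Circle.smul_def, smul_eq_mul]
      have := hcl l
      exact (Continuous.aestronglyMeasurable (by fun_prop)).enorm

theorem eLpNorm_rpow' {X : Type*} [MeasurableSpace X] {μ : Measure X} (g : X → ℂ) {p : ℝ≥0∞}
    (hp : 0 < p) (hp1 : p < 1) : eLpNorm g p μ ^ p.toReal = ∫⁻ x, ‖g x‖ₑ ^ p.toReal ∂μ := by
  have hpt : p ≠ ∞ := (hp1.trans ENNReal.one_lt_top).ne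
  rw [eLpNorm_eq_lintegral_rpow_enorm_toReal hp.ne' hpt, ← ENNReal.rpow_mul,
    one_div_mul_cancel (ENNReal.toReal_pos hp.ne' hpt).ne', ENNReal.rpow_one]

end PartFour

/-- For `n = m+1 ≥ 2` and `0 < p < 1` there exist `N` and `C` such that for
every Schwartz `f` and every `k̄ ∈ ℤ^{n-1}`,
`‖□_{k̄}(Tr f)‖_{L^p(ℝ^{n-1})}^p ≤ C Σ_{l : |l̄-k̄|_∞ ≤ N} ‖□_l f‖_{L^p(ℝⁿ)}^p`. -/
theorem box_trace_le_sum_box_subone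
    (m : ℕ) (hm : 1 ≤ m) (η : ℝ → ℝ) (hη : IsBump η)
    (p : ℝ≥0∞) (hp : 0 < p) (hp1 : p < 1) :
    ∃ (N : ℕ) (C : ℝ≥0∞), 0 < C ∧ C ≠ ∞ ∧
      ∀ (f : SchwartzMap (EuclideanSpace ℝ (Fin (m+1))) ℂ) (k : Fin m → ℤ),
        eLpNorm (unifBox η k (traceFn (⇑f))) p volume ^ p.toReal ≤
          C * ∑' l : {l : Fin (m+1) → ℤ // ∀ i : Fin m, |l i.castSucc - k i| ≤ (N:ℤ)},
            eLpNorm (unifBox η l.1 (⇑f)) p volume ^ p.toReal := by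
  classical
  have hpt : p ≠ ∞ := (hp1.trans ENNReal.one_lt_top).ne
  have hr0 : 0 < p.toReal := ENNReal.toReal_pos hp.ne' hpt
  have hr1 : p.toReal < 1 := by
    have := (ENNReal.toReal_lt_toReal hpt ENNReal.one_ne_top).2 hp1
    simpa using this
  set r := p.toReal with hr
  obtain ⟨a₀, ha₀, -⟩ := exists_symbol hη (0 : Fin m → ℤ) 0
  obtain ⟨K, hK, hKb⟩ := slice_bound (𝓕⁻ a₀) hr0
  have hA₀ : ⇑(𝓕⁻ a₀ : SchwartzMap (EuclideanSpace ℝ (Fin (m+1))) ℂ) = 𝓕⁻ (⇑a₀) :=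
    SchwartzMap.fourierInv_coe a₀
  rw [hA₀] at hKb
  set W : ℝ≥0∞ := (volume (Metric.closedBall (0 : EuclideanSpace ℝ (Fin (m+1)))
    (2 * (2 * ((m+1 : ℕ) : ℝ))))) ^ (1 - r) with hW
  have hWt : W ≠ ∞ := ENNReal.rpow_ne_top_of_nonneg (by linarith) measure_closedBall_lt_top.ne
  refine ⟨1, W * K + 1, by positivity,
    ENNReal.add_ne_top.2 ⟨ENNReal.mul_ne_top hWt hK, ENNReal.one_ne_top⟩, ?_⟩
  intro f k
  rw [eLpNorm_rpow' _ hp hp1]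
  have hE : ∀ l : Fin (m+1) → ℤ, eLpNorm (unifBox η l (⇑f)) p volume ^ r =
      ∫⁻ y, ‖unifBox η l (⇑f) y‖ₑ ^ r := fun l => eLpNorm_rpow' _ hp hp1
  simp_rw [hE]
  have hFs : ContDiff ℝ (⊤ : ℕ∞) (𝓕 (⇑f)) := by
    rw [← SchwartzMap.fourier_coe]; exact (𝓕 f).smooth _
  have hc₀ : Continuous (𝓕⁻ (⇑a₀)) := by
    rw [← hA₀]; exact (𝓕⁻ a₀ : SchwartzMap (EuclideanSpace ℝ (Fin (m+1))) ℂ).continuous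
  have hcb : ∀ l, Continuous (unifBox η l (⇑f)) := by
    intro l
    obtain ⟨b, hb⟩ := exists_windowed hη l hFs
    have : unifBox η l (⇑f) = ⇑(𝓕⁻ b : SchwartzMap (EuclideanSpace ℝ (Fin (m+1))) ℂ) := by
      rw [SchwartzMap.fourierInv_coe]
      unfold unifBox
      congr 1; ext ξ; rw [hb]
    rw [this]
    exact (𝓕⁻ b : SchwartzMap (EuclideanSpace ℝ (Fin (m+1))) ℂ).continuous
  -- the pieces
  set G : (Fin (m+1) → ℤ) → EuclideanSpace ℝ (Fin m) → ℂ := fun l x =>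
    ∫ ξ, Real.fourierChar (inner ℝ ξ (appZero m x)) •
        ((unifWindow η k (restrLast m ξ) : ℂ) * ((unifWindow η l ξ : ℂ) * 𝓕 (⇑f) ξ)) with hG
  have hGb : ∀ l x, ‖G l x‖ₑ ^ r ≤
      W * ∫⁻ y, ‖𝓕⁻ (⇑a₀) (appZero m x - y)‖ₑ ^ r * ‖unifBox η l (⇑f) y‖ₑ ^ r := by
    intro l x
    obtain ⟨b, hb⟩ := exists_windowed hη l hFs
    obtain ⟨a, ha, has⟩ := exists_symbol hη k (l (Fin.last m))
    have hbf : ⇑b = fun ξ => (unifWindow η l ξ : ℂ) * 𝓕 (⇑f) ξ := funext hb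
    have hpb := piece_bound a b _ _ _ has
      (fun ξ hξ => by rw [hb, window_eq_zero_of_far hη l ξ hξ]; simp) hr0 hr1 (appZero m x)
    have e1 : G l x = ∫ ζ, Real.fourierChar (inner ℝ ζ (appZero m x)) • (a ζ * b ζ) := by
      rw [hG]
      apply integral_congr_ae
      refine Filter.Eventually.of_forall (fun ξ => ?_)
      simp only
      congr 1
      rw [ha, hb]
      by_cases h0 : unifWindow η l ξ = 0
      · rw [h0]; simp
      · have := window_support hη h0 (Fin.last m)
        rw [hη.2.2.1 _ this.le]; simp
    rw [e1]
    refine hpb.trans (le_of_eq ?_)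
    congr 1
    apply lintegral_congr
    intro y
    have e2 : ‖𝓕⁻ (⇑a) (appZero m x - y)‖ₑ = ‖𝓕⁻ (⇑a₀) (appZero m x - y)‖ₑ := by
      apply norm_fourierInv_translate _ _
        (WithLp.toLp 2 (fun i => ((Fin.snoc (α := fun _ => ℤ) k (l (Fin.last m)) i : ℤ) : ℝ)))
      intro ξ
      rw [ha, ha₀, window_translate k]
      congr 3
      · congr 1
        ext i
        simp
      · simp
    rw [e2, hbf]
    rfl
  have hG0 : ∀ l, ¬ (∀ i : Fin m, |l i.castSucc - k i| ≤ ((1:ℕ):ℤ)) → ∀ x, G l x = 0 := by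
    intro l hl x
    rw [hG]; simp only
    rw [← integral_zero (EuclideanSpace ℝ (Fin (m+1))) ℂ]
    congr 1; ext ξ
    by_cases h1 : unifWindow η k (restrLast m ξ) = 0
    · rw [h1]; simp
    by_cases h2 : unifWindow η l ξ = 0
    · rw [h2]; simp
    exfalso; apply hl
    intro i
    have h3 := abs_lt.1 (window_support hη h1 i)
    have h4 := abs_lt.1 (window_support hη h2 i.castSucc)
    rw [restrLast_apply] at h3
    have h5 : ((l i.castSucc - k i : ℤ) : ℝ) < ((2 : ℤ) : ℝ) := by push_cast; linarith
    have h6 : ((-2 : ℤ) : ℝ) < ((l i.castSucc - k i : ℤ) : ℝ) := by push_cast; linarith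
    have h5' := Int.cast_lt.1 h5
    have h6' := Int.cast_lt.1 h6
    rw [abs_le]; push_cast
    constructor <;> linarith
  set S : Set (Fin (m+1) → ℤ) := {l | ∀ i : Fin m, |l i.castSucc - k i| ≤ ((1:ℕ):ℤ)} with hS
  have hpt' : ∀ x, ‖unifBox η k (traceFn (⇑f)) x‖ₑ ^ r ≤ ∑' l : S,
      W * ∫⁻ y, ‖𝓕⁻ (⇑a₀) (appZero m x - y)‖ₑ ^ r * ‖unifBox η l.1 (⇑f) y‖ₑ ^ r := by
    intro x
    rw [box_trace_tsum hη]
    calc _ ≤ (∑' l, ‖G l x‖ₑ) ^ r := by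
          gcongr
          exact enorm_tsum_le_tsum_enorm
      _ ≤ ∑' l, ‖G l x‖ₑ ^ r := tsum_rpow_le' _ hr0 hr1
      _ = ∑' l : S, ‖G l.1 x‖ₑ ^ r := by
          symm
          apply tsum_subtype_eq_of_support_subset (f := fun l => ‖G l x‖ₑ ^ r)
          intro l hl
          by_contra hns
          apply hl
          simp only
          rw [hG0 l hns x]
          simp [ENNReal.zero_rpow_of_pos hr0]
      _ ≤ _ := ENNReal.tsum_le_tsum (fun l => hGb l.1 x)
  have hmeas : ∀ l : Fin (m+1) → ℤ, Measurable (Function.uncurry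
      (fun (x : EuclideanSpace ℝ (Fin m)) (y : EuclideanSpace ℝ (Fin (m+1))) =>
      ‖𝓕⁻ (⇑a₀) (appZero m x - y)‖ₑ ^ r * ‖unifBox η l (⇑f) y‖ₑ ^ r)) := by
    intro l
    have h1 := hcb l
    have h2 : Continuous (fun q : EuclideanSpace ℝ (Fin m) × EuclideanSpace ℝ (Fin (m+1)) =>
      𝓕⁻ (⇑a₀) (appZero m q.1 - q.2)) := by fun_prop
    have h3 : Continuous (fun q : EuclideanSpace ℝ (Fin m) × EuclideanSpace ℝ (Fin (m+1)) =>
      unifBox η l (⇑f) q.2) := by fun_prop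
    exact (h2.measurable.enorm.pow_const r).mul (h3.measurable.enorm.pow_const r)
  calc _ ≤ ∫⁻ x, ∑' l : S, W * ∫⁻ y, ‖𝓕⁻ (⇑a₀) (appZero m x - y)‖ₑ ^ r *
          ‖unifBox η l.1 (⇑f) y‖ₑ ^ r := lintegral_mono hpt'
    _ = ∑' l : S, ∫⁻ x, W * ∫⁻ y, ‖𝓕⁻ (⇑a₀) (appZero m x - y)‖ₑ ^ r *
          ‖unifBox η l.1 (⇑f) y‖ₑ ^ r := by
        apply lintegral_tsum
        intro l
        exact ((hmeas l.1).lintegral_prod_right.const_mul W).aemeasurable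
    _ ≤ ∑' l : S, (W * K + 1) * ∫⁻ y, ‖unifBox η l.1 (⇑f) y‖ₑ ^ r := by
        apply ENNReal.tsum_le_tsum
        intro l
        have hml : Measurable (fun y => ‖unifBox η l.1 (⇑f) y‖ₑ ^ r) :=
          (hcb l.1).measurable.enorm.pow_const r
        rw [lintegral_const_mul _ (hmeas l.1).lintegral_prod_right,
          lintegral_lintegral_swap (hmeas l.1).aemeasurable]
        calc _ ≤ W * ∫⁻ y, K * ‖unifBox η l.1 (⇑f) y‖ₑ ^ r := by
              gcongr with y
              rw [lintegral_mul_const _ (by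
                have : Continuous (fun x => 𝓕⁻ (⇑a₀) (appZero m x - y)) := by fun_prop
                exact this.measurable.enorm.pow_const r)]
              gcongr
              exact hKb y
          _ = W * K * ∫⁻ y, ‖unifBox η l.1 (⇑f) y‖ₑ ^ r := by
              rw [lintegral_const_mul _ hml, mul_assoc]
          _ ≤ _ := by gcongr; exact le_self_add
    _ = _ := by rw [ENNReal.tsum_mul_left]; rfl
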